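/- There exist a constant c > 0 and an integer k₀ such that for all k ≥ k₀, N(k) ≥ c·log k, where N(k) is the number of positive integers n with ⌈log₃ n⌉ = k and B(n) ≠ k. (Main theorem, second form: N(k) ∈ Ω(log k).) -/

import Mathlib

/-- A weighing matrix has all entries in `{-1, 0, 1}`. -/
def IsWeighing {k n : ℕ} (M : Matrix (Fin k) (Fin n) ℤ) : Prop :=
  ∀ i j, M i j = -1 ∨ M i j = 0 ∨ M i j = 1

/-- The vector of coin weights `(1, 2, …, n)`. -/
def coinVec (n : ℕ) : Fin n → ℤ := fun j => (j : ℤ) + 1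

/-- The componentwise sign of `M · v` where `v = (1, …, n)`. -/
def wvec {k n : ℕ} (M : Matrix (Fin k) (Fin n) ℤ) : Fin k → ℤ :=
  fun i => Int.sign (Matrix.mulVec M (coinVec n) i)

/-- `M` is Münchhausen: a weighing matrix such that for every permutation matrix `π`,
`w(M·π) = w(M)` implies `π = I`. -/
def IsMunchhausen {k n : ℕ} (M : Matrix (Fin k) (Fin n) ℤ) : Prop :=
  IsWeighing M ∧
    ∀ π : Equiv.Perm (Fin n), wvec (M * π.permMatrix ℤ) = wvec M → π = 1

/-- `M` with its rows permuted according to `σ`. -/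
def rowPerm {k n : ℕ} (σ : Equiv.Perm (Fin k)) (M : Matrix (Fin k) (Fin n) ℤ) :
    Matrix (Fin k) (Fin n) ℤ :=
  Matrix.submatrix M σ id

/-- The Baron's omni-sequence: the least `k` for which a `k × n` Münchhausen matrix exists. -/
noncomputable def B (n : ℕ) : ℕ :=
  sInf {k : ℕ | ∃ M : Matrix (Fin k) (Fin n) ℤ, IsMunchhausen M}

/-- `N k` is the number of positive integers `n` with `⌈log₃ n⌉ = k` and `B n ≠ k`. -/
noncomputable def N (k : ℕ) : ℕ :=
  Nat.card {n : ℕ // 0 < n ∧ ⌈Real.logb 3 (n : ℝ)⌉ = (k : ℤ) ∧ B n ≠ k}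

/-- All vectors with entries in `{-1, 0, 1}`: the possible columns of a weighing matrix. -/
def ternaryVectors (k : ℕ) : Finset (Fin k → ℤ) :=
  Fintype.piFinset fun _ => {-1, 0, 1}

theorem mem_ternaryVectors {k : ℕ} {x : Fin k → ℤ} :
    x ∈ ternaryVectors k ↔ ∀ i, x i ∈ ({-1, 0, 1} : Finset ℤ) :=
  Fintype.mem_piFinset

theorem card_ternaryVectors (k : ℕ) : (ternaryVectors k).card = 3 ^ k := by
  simp [ternaryVectors]

theorem IsWeighing.transpose_mem {k n : ℕ} {M : Matrix (Fin k) (Fin n) ℤ} (hM : IsWeighing M)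
    (j : Fin n) : M.transpose j ∈ ternaryVectors k :=
  mem_ternaryVectors.2 fun i => by simpa using hM i j

/-- The columns of a Münchhausen matrix are pairwise distinct. -/
theorem IsMunchhausen.injective_transpose {k n : ℕ} {M : Matrix (Fin k) (Fin n) ℤ}
    (hM : IsMunchhausen M) : Function.Injective M.transpose := by
  intro a b hab
  have hswap : M * (Equiv.swap a b).permMatrix ℤ = M := by
    rw [Equiv.Perm.permMatrix, PEquiv.mul_toMatrix_toPEquiv]
    ext i j
    have hi : M i a = M i b := congrFun hab i
    simp only [Matrix.submatrix_apply, id, Equiv.symm_swap]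
    rcases eq_or_ne j a with rfl | ha
    · rw [Equiv.swap_apply_left, hi]
    rcases eq_or_ne j b with rfl | hb
    · rw [Equiv.swap_apply_right, hi]
    rw [Equiv.swap_apply_of_ne_of_ne ha hb]
  exact Equiv.swap_eq_one_iff.1 (hM.2 _ (by rw [hswap]))

/-- A row permutation that preserves both the weighing outcomes and the set of columns of a
Münchhausen matrix preserves the matrix. -/
theorem IsMunchhausen.rowPerm_eq {k n : ℕ} {M : Matrix (Fin k) (Fin n) ℤ} (hM : IsMunchhausen M)
    {σ : Equiv.Perm (Fin k)} (hw : ∀ i, wvec M (σ i) = wvec M i)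
    (hcol : ∀ j, ∃ j', ∀ i, M i j' = M (σ i) j) : rowPerm σ M = M := by
  choose ρ hρ using hcol
  have hinj : Function.Injective ρ := by
    intro a b hab
    apply hM.injective_transpose
    funext i
    have ha := hρ a (σ.symm i)
    rw [hab, hρ b, Equiv.apply_symm_apply] at ha
    exact ha.symm
  let π : Equiv.Perm (Fin n) := Equiv.ofBijective ρ (Finite.injective_iff_bijective.1 hinj)
  have hrow : M * Equiv.Perm.permMatrix ℤ π.symm = rowPerm σ M := by
    rw [Equiv.Perm.permMatrix, PEquiv.mul_toMatrix_toPEquiv]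
    ext i j
    exact hρ j i
  have hone : π.symm = 1 := by
    refine hM.2 _ ?_
    rw [hrow]
    funext i
    exact hw i
  rw [← hrow, hone, Matrix.permMatrix_one, Matrix.mul_one]

/-- If only `m` ternary vectors are missing from the columns of a Münchhausen matrix with `k` rows,
then `k ≤ 3 ^ (m + 1)`: otherwise two rows have the same outcome and the same entries in the missing
columns, and exchanging them permutes the columns. -/
theorem IsMunchhausen.le_three_pow {k n m : ℕ} {M : Matrix (Fin k) (Fin n) ℤ}
    (hM : IsMunchhausen M) (hm : n + m = 3 ^ k) : k ≤ 3 ^ (m + 1) := by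
  classical
  by_contra! hlt
  let C : Finset (Fin k → ℤ) := Finset.univ.image M.transpose
  have hC (j : Fin n) : M.transpose j ∈ C := Finset.mem_image_of_mem _ (Finset.mem_univ j)
  have hCsub : C ⊆ ternaryVectors k :=
    Finset.image_subset_iff.2 fun j _ => hM.1.transpose_mem j
  have hCcard : C.card = n := by
    simp [C, Finset.card_image_of_injective _ hM.injective_transpose]
  let S : Finset (Fin k → ℤ) := ternaryVectors k \ C
  have hScard : S.card = m := by
    rw [Finset.card_sdiff_of_subset hCsub, card_ternaryVectors, hCcard]
    lia
  let f : Fin k → ℤ × (S → ℤ) := fun i => (wvec M i, fun x => x.1 i)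
  obtain ⟨a, -, b, -, hab, hf⟩ := Finset.exists_ne_map_eq_of_card_lt_of_maps_to
    (s := Finset.univ) (f := f)
    (t := ({-1, 0, 1} : Finset ℤ) ×ˢ Fintype.piFinset fun _ : S => ({-1, 0, 1} : Finset ℤ))
    (by simpa [hScard, pow_succ'] using hlt)
    (by
      intro i _
      refine Finset.mem_product.2 ⟨?_, Fintype.mem_piFinset.2 fun x =>
        mem_ternaryVectors.1 (Finset.mem_sdiff.1 x.2).1 i⟩
      rcases Int.sign_trichotomy (Matrix.mulVec M (coinVec n) i) with h | h | h <;>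
        simp [f, wvec, h])
  have hwab : wvec M a = wvec M b := congrArg Prod.fst hf
  have hSab (x) (hx : x ∈ S) : x a = x b := congrFun (congrArg Prod.snd hf) ⟨x, hx⟩
  have apply_swap {g : Fin k → ℤ} (hg : g a = g b) (i : Fin k) : g (Equiv.swap a b i) = g i := by
    rw [Equiv.swap_apply_def]
    split_ifs with h₁ h₂
    · rw [h₁, hg]
    · rw [h₂, hg]
    · rfl
  have hcol (j : Fin n) : ∃ j', ∀ i, M i j' = M (Equiv.swap a b i) j := by
    let y : Fin k → ℤ := fun i => M (Equiv.swap a b i) j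
    suffices hy : y ∈ C by
      obtain ⟨j', -, hj'⟩ := Finset.mem_image.1 hy
      exact ⟨j', congrFun hj'⟩
    by_contra hyC
    have hyS : y ∈ S := Finset.mem_sdiff.2
      ⟨mem_ternaryVectors.2 fun i => mem_ternaryVectors.1 (hM.1.transpose_mem j) _, hyC⟩
    refine hyC ?_
    convert hC j using 1
    funext i
    rw [← apply_swap (hSab y hyS) i]
    simp [y, Matrix.transpose_apply]
  have hfix := hM.rowPerm_eq (apply_swap hwab) hcol
  have hsingle : Pi.single a 1 ∈ ternaryVectors k := mem_ternaryVectors.2 fun i => by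
    by_cases h : i = a <;> simp [h]
  have hne : (Pi.single a 1 : Fin k → ℤ) a ≠ (Pi.single a 1 : Fin k → ℤ) b := by
    simp [hab.symm]
  by_cases hmem : Pi.single a 1 ∈ C
  · obtain ⟨j, -, hj⟩ := Finset.mem_image.1 hmem
    rw [← hj] at hne
    apply hne
    simpa [rowPerm] using (congrFun (congrFun hfix a) j).symm
  · exact hne (hSab _ (Finset.mem_sdiff.2 ⟨hsingle, hmem⟩))

theorem B_ne_of_three_pow_lt {k n m : ℕ} (hm : n + m = 3 ^ k) (hk : 3 ^ (m + 1) < k) :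
    B n ≠ k := by
  intro hB
  have hmem := Nat.sInf_mem (Nat.nonempty_of_pos_sInf (hB.trans_gt (Nat.zero_lt_of_lt hk)))
  obtain ⟨M, hM⟩ : ∃ M : Matrix (Fin k) (Fin n) ℤ, IsMunchhausen M := hB ▸ hmem
  exact hk.not_ge (hM.le_three_pow hm)

theorem ceil_logb_three_eq_iff {n k : ℕ} : ⌈Real.logb 3 (n : ℝ)⌉ = (k : ℤ) ↔ Nat.clog 3 n = k := by
  have h := Real.ceil_logb_natCast (b := 3) (Nat.cast_nonneg (α := ℝ) n)
  rw [Nat.cast_ofNat, Int.clog_natCast] at h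
  rw [h, Nat.cast_inj]

/-- There are at least as many exceptional `n` as there are `m` with `3 ^ (m + 1) < k`, namely
`n = 3 ^ k - m`. -/
theorem log_pred_le_N (k : ℕ) : Nat.log 3 (k - 1) ≤ N k := by
  have hfin : Finite {n : ℕ // 0 < n ∧ ⌈Real.logb 3 (n : ℝ)⌉ = (k : ℤ) ∧ B n ≠ k} := by
    refine Set.Finite.to_subtype ((Set.finite_Iic (3 ^ k)).subset ?_)
    rintro n ⟨-, hn, -⟩
    exact (Nat.clog_le_iff_le_pow (by norm_num)).1 (ceil_logb_three_eq_iff.1 hn).le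
  have hpow (m : Fin (Nat.log 3 (k - 1))) : 3 ^ (m.1 + 1) < k := by
    have hk : k - 1 ≠ 0 := by
      intro h
      have := m.2
      simp [h] at this
    have := Nat.pow_le_of_le_log hk m.2
    lia
  have hlt (m : Fin (Nat.log 3 (k - 1))) : m.1 + 3 ^ (k - 1) < 3 ^ k := by
    have h₁ : m.1 < 3 ^ (k - 1) := by
      have := hpow m
      have := Nat.lt_pow_self (n := m.1 + 1) (a := 3) (by norm_num)
      have := Nat.lt_pow_self (n := k - 1) (a := 3) (by norm_num)
      lia
    have h₂ : 3 ^ k = 3 * 3 ^ (k - 1) := by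
      rw [← pow_succ', Nat.sub_add_cancel (Nat.one_le_of_lt (hpow m))]
    lia
  let g (m : Fin (Nat.log 3 (k - 1))) :
      {n : ℕ // 0 < n ∧ ⌈Real.logb 3 (n : ℝ)⌉ = (k : ℤ) ∧ B n ≠ k} :=
    ⟨3 ^ k - m.1, by have := hlt m; lia, by
      refine ceil_logb_three_eq_iff.2 (le_antisymm ?_ ?_)
      · exact Nat.clog_le_of_le_pow (Nat.sub_le _ _)
      · refine Nat.le_of_pred_lt ((Nat.lt_clog_iff_pow_lt (by norm_num)).2 ?_)
        have := hlt m
        rw [Nat.pred_eq_sub_one]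
        lia,
      B_ne_of_three_pow_lt (Nat.sub_add_cancel (by have := hlt m; lia)) (hpow m)⟩
  have hg : Function.Injective g := by
    intro m m' h
    have h' : 3 ^ k - m.1 = 3 ^ k - m'.1 := congrArg Subtype.val h
    have := hlt m
    have := hlt m'
    exact Fin.ext (by lia)
  simpa [N] using Nat.card_le_card_of_injective g hg

/-- Main theorem, second form: `N(k) ∈ Ω(log k)`. -/
theorem main_theorem_second_form :
    ∃ c : ℝ, 0 < c ∧ ∃ k₀ : ℕ, ∀ k : ℕ, k₀ ≤ k → c * Real.log k ≤ (N k : ℝ) := by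
  refine ⟨1 / (2 * Real.log 3), by positivity, 4, fun k hk => ?_⟩
  set r := Nat.log 3 (k - 1)
  have hr : 1 ≤ r := Nat.log_pos (by norm_num) (by lia)
  have hkr : k ≤ 3 ^ (r + 1) := by
    have := Nat.lt_pow_succ_log_self (b := 3) (by norm_num) (k - 1)
    rw [Nat.succ_eq_add_one] at this
    lia
  have hlog : Real.log k ≤ (r + 1) * Real.log 3 := by
    have h : Real.log k ≤ Real.log ((3 : ℝ) ^ (r + 1)) :=
      Real.log_le_log (by norm_cast; lia) (by exact_mod_cast hkr)
    simpa using h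
  have hr' : (1 : ℝ) ≤ r := by exact_mod_cast hr
  have h3 : 0 < Real.log 3 := Real.log_pos (by norm_num)
  calc 1 / (2 * Real.log 3) * Real.log k ≤ r := by
        rw [one_div_mul_eq_div, div_le_iff₀ (by positivity)]
        nlinarith
    _ ≤ N k := by exact_mod_cast log_pred_le_N k
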